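/- Let ρ > 0 and δ > 0, and suppose (x*, z*, λ*) ∈ ℝ^n × ℝ^{mN} × ℝ^{mN} satisfies: (a) 0 ∈ F(x*) + Λᵀ λ* + N_Ω(x*); (b) 𝑳 λ* = 0; (c) 0 ∈ N_{ℝ^{mN}_{≥0}}(λ*) + b̄ − Λ x* + ρ z* + (2δρ² + 1) 𝑳 λ*; and (d) (𝟙_Nᵀ ⊗ I_m) z* = 0. Then the blocks λ*_1, …, λ*_N of λ* are all equal to a common λ̄ ∈ ℝ^m_{≥0}, (x*, λ̄) satisfies the KKT conditions 0 ∈ ∇_{x_i} f_i(x*) + A_iᵀ λ̄ + N_{Ω_i}(x*_i) for every i and 0 ∈ b − A x* + N_{ℝ^m_{≥0}}(λ̄), and x* is the unique v-GNE of the game: x* ∈ 𝒳 and ⟨F(x*), x − x*⟩ ≥ 0 for all x ∈ 𝒳. (Theorem 1.) -/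

import Mathlib

open Matrix Filter
open scoped BigOperators

noncomputable section

/-- Block dot product on `∏ i, ℝ^{n_i}` (the Euclidean inner product on `ℝ^n`,
`n = n_1 + … + n_N`, after stacking). -/
def bdot {N : ℕ} {nd : Fin N → ℕ} (u v : ∀ i, Fin (nd i) → ℝ) : ℝ :=
  ∑ i, u i ⬝ᵥ v i

/-- Euclidean inner product on `ℝ^{m·K}` viewed as `Fin K → Fin m → ℝ`. -/
def mdot {K m : ℕ} (u v : Fin K → Fin m → ℝ) : ℝ := ∑ l, u l ⬝ᵥ v l

/-- Euclidean norm on the stacked space `∏ i, ℝ^{n_i}`. -/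
def bnorm {N : ℕ} {nd : Fin N → ℕ} (u : ∀ i, Fin (nd i) → ℝ) : ℝ := Real.sqrt (bdot u u)

/-- Euclidean norm on `ℝ^d`. -/
def vnorm {d : ℕ} (v : Fin d → ℝ) : ℝ := Real.sqrt (v ⬝ᵥ v)

/-- Normal cone to `C ⊆ ℝ^d` at `x`: empty when `x ∉ C`. -/
def nCone {d : ℕ} (C : Set (Fin d → ℝ)) (x : Fin d → ℝ) : Set (Fin d → ℝ) :=
  {u | x ∈ C ∧ ∀ y ∈ C, u ⬝ᵥ (y - x) ≤ 0}

/-- Normal cone to a subset of the stacked space `ℝ^n = ∏ i, ℝ^{n_i}`. -/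
def nConeB {N : ℕ} {nd : Fin N → ℕ} (C : Set (∀ i, Fin (nd i) → ℝ))
    (x : ∀ i, Fin (nd i) → ℝ) : Set (∀ i, Fin (nd i) → ℝ) :=
  {u | x ∈ C ∧ ∀ y ∈ C, bdot u (y - x) ≤ 0}

/-- Normal cone to a subset of `ℝ^{m·K}`. -/
def nConeM {K m : ℕ} (C : Set (Fin K → Fin m → ℝ)) (x : Fin K → Fin m → ℝ) :
    Set (Fin K → Fin m → ℝ) :=
  {u | x ∈ C ∧ ∀ y ∈ C, mdot u (y - x) ≤ 0}

/-- Nonnegative orthant `ℝ^{m·K}_{≥0}`. -/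
def posOrthM {K m : ℕ} : Set (Fin K → Fin m → ℝ) := {lam | ∀ i j, 0 ≤ lam i j}

/-- Nonnegative orthant `ℝ^m_{≥0}`. -/
def posOrthV {m : ℕ} : Set (Fin m → ℝ) := {v | ∀ j, 0 ≤ v j}

/-- `𝑽 λ = (V ⊗ I_m) λ`, acting blockwise. -/
def bigV {E N m : ℕ} (V : Matrix (Fin E) (Fin N) ℝ) (lam : Fin N → Fin m → ℝ) :
    Fin E → Fin m → ℝ := fun l => ∑ j, V l j • lam j

/-- `𝑽ᵀ σ = (Vᵀ ⊗ I_m) σ`, acting blockwise. -/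
def bigVT {E N m : ℕ} (V : Matrix (Fin E) (Fin N) ℝ) (σ : Fin E → Fin m → ℝ) :
    Fin N → Fin m → ℝ := fun i => ∑ l, V l i • σ l

/-- `𝑳 λ = (L ⊗ I_m) λ` where `L = VᵀV` is the graph Laplacian. -/
def bigL {E N m : ℕ} (V : Matrix (Fin E) (Fin N) ℝ) (lam : Fin N → Fin m → ℝ) :
    Fin N → Fin m → ℝ := bigVT V (bigV V lam)

/-- `Λᵀ λ` for the block-diagonal matrix `Λ = diag(A_1, …, A_N)`. -/
def lamT {N m : ℕ} {nd : Fin N → ℕ} (A : ∀ i, Matrix (Fin m) (Fin (nd i)) ℝ)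
    (lam : Fin N → Fin m → ℝ) : ∀ i, Fin (nd i) → ℝ := fun i => (A i)ᵀ *ᵥ lam i

/-- `Λ x` for the block-diagonal matrix `Λ = diag(A_1, …, A_N)`. -/
def lamB {N m : ℕ} {nd : Fin N → ℕ} (A : ∀ i, Matrix (Fin m) (Fin (nd i)) ℝ)
    (x : ∀ i, Fin (nd i) → ℝ) : Fin N → Fin m → ℝ := fun i => A i *ᵥ x i

/-- The product set `Ω = Ω_1 × ⋯ × Ω_N`. -/
def prodSet {N : ℕ} {nd : Fin N → ℕ} (Ω : ∀ i, Set (Fin (nd i) → ℝ)) :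
    Set (∀ i, Fin (nd i) → ℝ) := {x | ∀ i, x i ∈ Ω i}

/-- Feasible set `𝒳 = Ω ∩ {x : A x ≤ btot}`. -/
def feasSet {N m : ℕ} {nd : Fin N → ℕ} (Ω : ∀ i, Set (Fin (nd i) → ℝ))
    (A : ∀ i, Matrix (Fin m) (Fin (nd i)) ℝ) (btot : Fin m → ℝ) :
    Set (∀ i, Fin (nd i) → ℝ) :=
  {x | (∀ i, x i ∈ Ω i) ∧ ∀ j, (∑ i, A i *ᵥ x i) j ≤ btot j}

/-- `x*` is a variational GNE: it solves `VI(F, 𝒳)`. -/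
def isVGNE {N m : ℕ} {nd : Fin N → ℕ} (Ω : ∀ i, Set (Fin (nd i) → ℝ))
    (A : ∀ i, Matrix (Fin m) (Fin (nd i)) ℝ) (btot : Fin m → ℝ)
    (F : (∀ i, Fin (nd i) → ℝ) → ∀ i, Fin (nd i) → ℝ)
    (xs : ∀ i, Fin (nd i) → ℝ) : Prop :=
  xs ∈ feasSet Ω A btot ∧ ∀ x ∈ feasSet Ω A btot, 0 ≤ bdot (F xs) (x - xs)

/-- degree of node `i`: number of edges incident to `i` (= `|𝒩_i|`). -/
def deg {E N : ℕ} (V : Matrix (Fin E) (Fin N) ℝ) (i : Fin N) : ℕ :=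
  (Finset.univ.filter fun l => V l i ≠ 0).card

/-- The kernel of `VᵀV ⊗ I` is contained in the kernel of `V ⊗ I`. -/
theorem mulVec_eq_zero_of_bigL_eq_zero {E N m : ℕ} (V : Matrix (Fin E) (Fin N) ℝ)
    (lam : Fin N → Fin m → ℝ) (h : bigL V lam = 0) (j : Fin m) :
    V *ᵥ (fun i => lam i j) = 0 := by
  have hL : Vᵀ *ᵥ (V *ᵥ fun i => lam i j) = 0 := by
    funext i
    have := congrFun (congrFun h i) j
    simpa [bigL, bigVT, bigV, mulVec, dotProduct, Finset.sum_apply] using this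
  have h0 : (V *ᵥ fun i => lam i j) ⬝ᵥ (V *ᵥ fun i => lam i j) = 0 := by
    rw [dotProduct_mulVec, ← mulVec_transpose, hL, zero_dotProduct]
  exact dotProduct_self_eq_zero.mp h0

/-- The normal cone to a product set is contained in the product of the normal cones. -/
theorem mem_nCone_of_mem_nConeB_prodSet {N : ℕ} {nd : Fin N → ℕ}
    {Ω : ∀ i, Set (Fin (nd i) → ℝ)} {x u : ∀ i, Fin (nd i) → ℝ}
    (h : u ∈ nConeB (prodSet Ω) x) (i : Fin N) : u i ∈ nCone (Ω i) (x i) := by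
  refine ⟨h.1 i, fun y hy => ?_⟩
  have hmem : Function.update x i y ∈ prodSet Ω := by
    intro k
    by_cases hk : k = i
    · subst hk
      simpa using hy
    · simpa [hk] using h.1 k
  have hle := h.2 _ hmem
  rw [bdot, Finset.sum_eq_single i] at hle
  · simpa using hle
  · intro k _ hk
    simp [hk]
  · simp

/-- Normal vectors to the orthant at a consensual point sum to a normal vector at the common
block. -/
theorem sum_mem_nCone_posOrthV {K m : ℕ} {lam u : Fin K → Fin m → ℝ} {c : Fin m → ℝ}
    (h : u ∈ nConeM posOrthM lam) (hlam : ∀ i, lam i = c) (hc : c ∈ posOrthV) :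
    ∑ i, u i ∈ nCone posOrthV c := by
  refine ⟨hc, fun y hy => ?_⟩
  have hle := h.2 (fun _ => y) fun _ j => hy j
  simpa [mdot, hlam, sum_dotProduct] using hle

/-- Normal vectors to the nonnegative orthant are nonpositive. -/
theorem nonpos_of_mem_nCone_posOrthV {m : ℕ} {c u : Fin m → ℝ} (h : u ∈ nCone posOrthV c)
    (j : Fin m) : u j ≤ 0 := by
  have hle := h.2 (c + Pi.single j 1) fun k =>
    add_nonneg (h.1 k) (by by_cases hk : k = j <;> simp [hk])
  simpa using hle

/-- Normal vectors to the nonnegative orthant satisfy the complementarity inequality. -/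
theorem dotProduct_nonneg_of_mem_nCone_posOrthV {m : ℕ} {c u : Fin m → ℝ}
    (h : u ∈ nCone posOrthV c) : 0 ≤ u ⬝ᵥ c := by
  have hle := h.2 0 fun _ => le_rfl
  simpa using hle

/-- A KKT point solves the variational inequality over the feasible set. -/
theorem isVGNE_of_kkt {N m : ℕ} {nd : Fin N → ℕ} {Ω : ∀ i, Set (Fin (nd i) → ℝ)}
    {A : ∀ i, Matrix (Fin m) (Fin (nd i)) ℝ} {btot : Fin m → ℝ}
    {F : (∀ i, Fin (nd i) → ℝ) → ∀ i, Fin (nd i) → ℝ} {xs : ∀ i, Fin (nd i) → ℝ}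
    {c : Fin m → ℝ} (hstat : ∀ i, (-(F xs i) - (A i)ᵀ *ᵥ c) ∈ nCone (Ω i) (xs i))
    (hcomp : ((∑ i, A i *ᵥ xs i) - btot) ∈ nCone posOrthV c) :
    isVGNE Ω A btot F xs := by
  refine ⟨⟨fun i => (hstat i).1, fun j => ?_⟩, fun x hx => ?_⟩
  · simpa using nonpos_of_mem_nCone_posOrthV hcomp j
  · have hblock : ∀ i, (A i *ᵥ xs i) ⬝ᵥ c - (A i *ᵥ x i) ⬝ᵥ c ≤ F xs i ⬝ᵥ (x - xs) i := by
      intro i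
      have hle := (hstat i).2 (x i) (hx.1 i)
      have hadj : ((A i)ᵀ *ᵥ c) ⬝ᵥ (x i - xs i) = (A i *ᵥ x i) ⬝ᵥ c - (A i *ᵥ xs i) ⬝ᵥ c := by
        rw [mulVec_transpose, ← dotProduct_mulVec, mulVec_sub, dotProduct_sub,
          dotProduct_comm c, dotProduct_comm c]
      rw [sub_dotProduct, neg_dotProduct, hadj] at hle
      rw [Pi.sub_apply]
      linarith
    have hsum := Finset.sum_le_sum fun i (_ : i ∈ Finset.univ) => hblock i
    rw [Finset.sum_sub_distrib, ← sum_dotProduct, ← sum_dotProduct] at hsum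
    have hcs := dotProduct_nonneg_of_mem_nCone_posOrthV hcomp
    rw [sub_dotProduct] at hcs
    have hfeas : (∑ i, A i *ᵥ x i) ⬝ᵥ c ≤ btot ⬝ᵥ c :=
      Finset.sum_le_sum fun j _ => mul_le_mul_of_nonneg_right (hx.2 j) (hcomp.1 j)
    unfold bdot
    linarith

/-- A strongly monotone variational inequality has at most one solution. -/
theorem isVGNE_unique {N m : ℕ} {nd : Fin N → ℕ} {Ω : ∀ i, Set (Fin (nd i) → ℝ)}
    {A : ∀ i, Matrix (Fin m) (Fin (nd i)) ℝ} {btot : Fin m → ℝ}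
    {F : (∀ i, Fin (nd i) → ℝ) → ∀ i, Fin (nd i) → ℝ} {α : ℝ} (hα : 0 < α)
    (hmono : ∀ x y, α * bdot (x - y) (x - y) ≤ bdot (F x - F y) (x - y))
    {x y : ∀ i, Fin (nd i) → ℝ} (hx : isVGNE Ω A btot F x) (hy : isVGNE Ω A btot F y) :
    y = x := by
  have hxy := hx.2 y hy.1
  have hyx := hy.2 x hx.1
  have hm := hmono y x
  have hsplit : bdot (F y - F x) (y - x) = -bdot (F y) (x - y) - bdot (F x) (y - x) := by
    simp only [bdot, Pi.sub_apply, sub_dotProduct, dotProduct_sub, Finset.sum_sub_distrib]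
    ring
  have hnonneg : ∀ i, 0 ≤ (y - x) i ⬝ᵥ (y - x) i := fun i =>
    Finset.sum_nonneg fun k _ => mul_self_nonneg _
  have hzero : bdot (y - x) (y - x) = 0 := by
    refine le_antisymm ?_ (Finset.sum_nonneg fun i _ => hnonneg i)
    by_contra hpos
    have := mul_pos hα (not_le.mp hpos)
    linarith
  have hall := (Finset.sum_eq_zero_iff_of_nonneg fun i _ => hnonneg i).mp hzero
  funext i
  exact sub_eq_zero.mp (dotProduct_self_eq_zero.mp (hall i (Finset.mem_univ i)))

/-- Theorem 1: if `(x*, z*, λ*)` satisfies the node-variable equilibrium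
conditions (a)–(d), then all dual blocks of `λ*` equal a common `λ̄ ∈ ℝ^m_{≥0}`, `(x*, λ̄)`
satisfies the KKT conditions, and `x*` is the unique v-GNE of the game. -/
theorem node_variable_equilibrium_is_vGNE
    {N m E : ℕ} (hN : 2 ≤ N) (hE : 1 ≤ E) {nd : Fin N → ℕ}
    (Ω : ∀ i, Set (Fin (nd i) → ℝ))
    (hΩne : ∀ i, (Ω i).Nonempty) (hΩcp : ∀ i, IsCompact (Ω i)) (hΩcv : ∀ i, Convex ℝ (Ω i))
    (A : ∀ i, Matrix (Fin m) (Fin (nd i)) ℝ) (b : Fin N → Fin m → ℝ)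
    (hSlater : ∃ x : ∀ i, Fin (nd i) → ℝ, (∀ i, x i ∈ Ω i) ∧
      ∀ j, (∑ i, A i *ᵥ x i) j < (∑ i, b i) j)
    (V : Matrix (Fin E) (Fin N) ℝ)
    (hV : ∀ l, ∃ i j, i ≠ j ∧ V l i = 1 ∧ V l j = -1 ∧ ∀ t, t ≠ i → t ≠ j → V l t = 0)
    (hconn : ∀ y : Fin N → ℝ, V *ᵥ y = 0 → ∃ c : ℝ, ∀ i, y i = c)
    (F : (∀ i, Fin (nd i) → ℝ) → ∀ i, Fin (nd i) → ℝ) (hFc : Continuous F)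
    (α ℓ : ℝ) (hα : 0 < α) (hℓ : 0 < ℓ)
    (hmono : ∀ x y, α * bdot (x - y) (x - y) ≤ bdot (F x - F y) (x - y))
    (hlip : ∀ x y, bnorm (F x - F y) ≤ ℓ * bnorm (x - y))
    (ρ δ : ℝ) (hρ : 0 < ρ) (hδ : 0 < δ)
    (xs : ∀ i, Fin (nd i) → ℝ) (zs lams : Fin N → Fin m → ℝ)
    -- (a) 0 ∈ F(x*) + Λᵀλ* + N_Ω(x*)
    (ha : (-(F xs) - lamT A lams) ∈ nConeB (prodSet Ω) xs)
    -- (b) 𝑳 λ* = 0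
    (hb : bigL V lams = 0)
    -- (c) 0 ∈ N_{ℝ^{mN}_{≥0}}(λ*) + b̄ - Λx* + ρz* + (2δρ² + 1) 𝑳λ*
    (hc : (lamB A xs - b - ρ • zs - (2 * δ * ρ ^ 2 + 1) • bigL V lams)
        ∈ nConeM posOrthM lams)
    -- (d) (𝟙ᵀ ⊗ I_m) z* = 0
    (hd : ∑ i, zs i = (0 : Fin m → ℝ)) :
    ∃ lamBar : Fin m → ℝ,
      (∀ i, lams i = lamBar) ∧ lamBar ∈ posOrthV ∧
      (∀ i, (-(F xs i) - (A i)ᵀ *ᵥ lamBar) ∈ nCone (Ω i) (xs i)) ∧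
      ((∑ i, A i *ᵥ xs i) - (∑ i, b i)) ∈ nCone posOrthV lamBar ∧
      isVGNE Ω A (∑ i, b i) F xs ∧ (∀ y, isVGNE Ω A (∑ i, b i) F y → y = xs) := by
  choose c hcst using fun j => hconn _ (mulVec_eq_zero_of_bigL_eq_zero V lams hb j)
  have hlam : ∀ i, lams i = c := fun i => funext fun j => hcst j i
  have hpos : c ∈ posOrthV := fun j => hcst j ⟨0, by omega⟩ ▸ hc.1 ⟨0, by omega⟩ j
  have hstat : ∀ i, (-(F xs i) - (A i)ᵀ *ᵥ c) ∈ nCone (Ω i) (xs i) := by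
    intro i
    simpa [lamT, hlam] using mem_nCone_of_mem_nConeB_prodSet ha i
  have hcomp : ((∑ i, A i *ᵥ xs i) - (∑ i, b i)) ∈ nCone posOrthV c := by
    simpa [hb, lamB, Finset.sum_sub_distrib, ← Finset.smul_sum, hd] using
      sum_mem_nCone_posOrthV hc hlam hpos
  have hvgne : isVGNE Ω A (∑ i, b i) F xs := isVGNE_of_kkt hstat hcomp
  exact ⟨c, hlam, hpos, hstat, hcomp, hvgne, fun y hy => isVGNE_unique hα hmono hvgne hy⟩
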